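/- Let 0 < p < 1 be fixed, and consider the Poissonization limit: if N → ∞ with p fixed, then N · ∑_{i=0}^{N} C(N,i) p^i (1-p)^{N-i} ln((i+1)/(pN)) converges to 1/(2p) + 1/2. -/

import Mathlib

open Finset Filter

/-- The expectation of `f` under the binomial distribution with parameters `M` and `p`. -/
noncomputable def binomialExpect (p : ℝ) (M : ℕ) (f : ℕ → ℝ) : ℝ :=
  ∑ i ∈ Finset.range (M + 1), (M.choose i : ℝ) * p ^ i * (1 - p) ^ (M - i) * f i

lemma binomialExpect_add (p : ℝ) (M : ℕ) (f g : ℕ → ℝ) :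
    binomialExpect p M (fun i => f i + g i) = binomialExpect p M f + binomialExpect p M g := by
  simp only [binomialExpect, mul_add, Finset.sum_add_distrib]

lemma binomialExpect_const_mul (p : ℝ) (M : ℕ) (c : ℝ) (f : ℕ → ℝ) :
    binomialExpect p M (fun i => c * f i) = c * binomialExpect p M f := by
  simp only [binomialExpect, Finset.mul_sum]
  exact Finset.sum_congr rfl fun i _ => by ring

lemma binomialExpect_mono {p : ℝ} (hp0 : 0 ≤ p) (hp1 : p ≤ 1) (M : ℕ) {f g : ℕ → ℝ}
    (h : ∀ i, f i ≤ g i) : binomialExpect p M f ≤ binomialExpect p M g := by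
  have hq : 0 ≤ 1 - p := sub_nonneg.2 hp1
  exact Finset.sum_le_sum fun i _ => mul_le_mul_of_nonneg_left (h i) (by positivity)

lemma binomialExpect_succ (p : ℝ) (M : ℕ) (f : ℕ → ℝ) :
    binomialExpect p (M + 1) f =
      (1 - p) * binomialExpect p M f + p * binomialExpect p M (fun i => f (i + 1)) := by
  have key := Finset.sum_antidiagonal_choose_succ_mul
    (fun i j => p ^ i * (1 - p) ^ j * f i) M
  simp only [Finset.Nat.sum_antidiagonal_eq_sum_range_succ_mk] at key
  simp only [binomialExpect, Finset.mul_sum]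
  refine Eq.trans (Finset.sum_congr rfl fun i _ => ?_) (key.trans (congrArg₂ _
    (Finset.sum_congr rfl fun i _ => ?_) (Finset.sum_congr rfl fun i hi => ?_)))
  · ring
  · ring
  · rw [Nat.choose_symm (Nat.lt_succ_iff.1 (Finset.mem_range.1 hi))]
    ring

lemma binomialExpect_one (p : ℝ) (M : ℕ) : binomialExpect p M (fun _ => 1) = 1 := by
  induction M with
  | zero => simp [binomialExpect]
  | succ M ih => rw [binomialExpect_succ, ih]; ring

/-- The expectation of a quartic polynomial in the centred binomial variable. -/
lemma binomialExpect_quartic (p : ℝ) (M : ℕ) (a₀ a₁ a₂ a₃ a₄ : ℝ) :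
    binomialExpect p M (fun i => a₀ + a₁ * (i - M * p) + a₂ * (i - M * p) ^ 2
        + a₃ * (i - M * p) ^ 3 + a₄ * (i - M * p) ^ 4) =
      a₀ + a₂ * (M * p * (1 - p)) + a₃ * (M * p * (1 - p) * (1 - 2 * p))
        + a₄ * (3 * M ^ 2 * p ^ 2 * (1 - p) ^ 2
          + M * p * (1 - p) * (1 - 6 * p * (1 - p))) := by
  induction M generalizing a₀ a₁ a₂ a₃ a₄ with
  | zero => simp [binomialExpect]
  | succ M ih =>
    have shift (s : ℝ) (f : ℕ → ℝ) (hf : ∀ i : ℕ, f i = a₀ + a₁ * (i - M * p + s)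
        + a₂ * (i - M * p + s) ^ 2 + a₃ * (i - M * p + s) ^ 3 + a₄ * (i - M * p + s) ^ 4) :
        binomialExpect p M f = _ :=
      (congrArg (binomialExpect p M) (funext fun i => by rw [hf i]; ring)).trans
        (ih (a₀ + a₁ * s + a₂ * s ^ 2 + a₃ * s ^ 3 + a₄ * s ^ 4)
          (a₁ + 2 * a₂ * s + 3 * a₃ * s ^ 2 + 4 * a₄ * s ^ 3)
          (a₂ + 3 * a₃ * s + 6 * a₄ * s ^ 2) (a₃ + 4 * a₄ * s) a₄)
    rw [binomialExpect_succ, shift (-p), shift (1 - p)]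
    · push_cast; ring
    · intro i; push_cast; ring
    · intro i; push_cast; ring

/-- Size-biasing: dividing by `B + 1` raises the number of trials by one. -/
lemma binomialExpect_succ_mul (p : ℝ) (N : ℕ) (f : ℕ → ℝ) :
    binomialExpect p (N + 1) (fun j => j * f j) =
      (N + 1) * p * binomialExpect p N (fun i => f (i + 1)) := by
  simp only [binomialExpect, Finset.mul_sum]
  rw [Finset.sum_range_succ']
  simp only [Nat.cast_zero, zero_mul, mul_zero, add_zero]
  refine Finset.sum_congr rfl fun i _ => ?_
  have h : ((N : ℝ) + 1) * N.choose i = (N + 1).choose (i + 1) * ((i : ℝ) + 1) := by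
    exact_mod_cast Nat.add_one_mul_choose_eq N i
  rw [Nat.add_sub_add_right]
  push_cast
  linear_combination -(p ^ (i + 1) * (1 - p) ^ (N - i) * f (i + 1)) * h

/-- The mean value theorem on `(0, ∞)`, based at a zero at `1`. -/
lemma exists_eq_deriv_mul_sub_one {f f' : ℝ → ℝ} (hf : ∀ x, 0 < x → HasDerivAt f (f' x) x)
    (h1 : f 1 = 0) {x : ℝ} (hx : 0 < x) :
    ∃ c, 0 < c ∧ 0 ≤ (c - 1) * (x - 1) ∧ f x = f' c * (x - 1) := by
  rcases lt_trichotomy x 1 with h | rfl | h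
  · obtain ⟨c, ⟨hc1, hc2⟩, hc⟩ := exists_hasDerivAt_eq_slope f f' h
      (fun y hy => (hf y (hx.trans_le hy.1)).continuousAt.continuousWithinAt)
      (fun y hy => hf y (hx.trans hy.1))
    refine ⟨c, hx.trans hc1, by nlinarith, ?_⟩
    rw [hc, h1]
    field_simp [(sub_pos.2 h).ne']
    ring
  · exact ⟨1, one_pos, by simp, by simp [h1]⟩
  · obtain ⟨c, ⟨hc1, hc2⟩, hc⟩ := exists_hasDerivAt_eq_slope f f' h
      (fun y hy => (hf y (one_pos.trans_le hy.1)).continuousAt.continuousWithinAt)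
      (fun y hy => hf y (one_pos.trans hy.1))
    refine ⟨c, one_pos.trans hc1, by nlinarith, ?_⟩
    rw [hc, h1]
    field_simp [(sub_pos.2 h).ne']
    ring

lemma Real.log_le_cubic {x : ℝ} (hx : 0 < x) :
    Real.log x ≤ (x - 1) - (x - 1) ^ 2 / 2 + (x - 1) ^ 3 / 3 := by
  obtain ⟨c, hc, hcx, h⟩ := exists_eq_deriv_mul_sub_one
    (f := fun y => (y - 1) - (y - 1) ^ 2 / 2 + (y - 1) ^ 3 / 3 - Real.log y)
    (f' := fun y => (y - 1) ^ 3 / y) (fun y hy => by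
      have hd := (hasDerivAt_id y).sub_const 1
      refine (((hd.sub ((hd.pow 2).div_const 2)).add ((hd.pow 3).div_const 3)).sub
        (Real.hasDerivAt_log hy.ne')).congr_deriv ?_
      simp only [id]
      field_simp
      ring) (by simp) hx
  have : 0 ≤ (c - 1) ^ 2 / c * ((c - 1) * (x - 1)) := by positivity
  have e : (c - 1) ^ 3 / c * (x - 1) = (c - 1) ^ 2 / c * ((c - 1) * (x - 1)) := by ring
  linarith

lemma Real.mul_log_le_quartic {x : ℝ} (hx : 0 ≤ x) :
    x * Real.log x ≤ (x - 1) + (x - 1) ^ 2 / 2 - (x - 1) ^ 3 / 6 + (x - 1) ^ 4 / 3 := by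
  rcases hx.eq_or_lt with rfl | hx
  · norm_num
  · linarith [mul_le_mul_of_nonneg_left (Real.log_le_cubic hx) hx.le]

lemma Real.cubic_le_mul_log {x : ℝ} (hx : 0 ≤ x) :
    (x - 1) + (x - 1) ^ 2 / 2 - (x - 1) ^ 3 / 6 ≤ x * Real.log x := by
  rcases hx.eq_or_lt with rfl | hx
  · norm_num
  obtain ⟨c, hc, hcx, h⟩ := exists_eq_deriv_mul_sub_one
    (f := fun y => y * Real.log y - ((y - 1) + (y - 1) ^ 2 / 2 - (y - 1) ^ 3 / 6))
    (f' := fun y => Real.log y - (y - 1) + (y - 1) ^ 2 / 2) (fun y hy => by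
      have hd := (hasDerivAt_id y).sub_const 1
      refine ((Real.hasDerivAt_mul_log hy.ne').sub
        ((hd.add ((hd.pow 2).div_const 2)).sub ((hd.pow 3).div_const 6))).congr_deriv ?_
      simp only [id]
      ring) (by simp) hx
  obtain ⟨d, hd, -, h'⟩ := exists_eq_deriv_mul_sub_one
    (f := fun y => Real.log y - (y - 1) + (y - 1) ^ 2 / 2)
    (f' := fun y => (y - 1) ^ 2 / y) (fun y hy => by
      have hd := (hasDerivAt_id y).sub_const 1
      refine (((Real.hasDerivAt_log hy.ne').sub hd).add
        ((hd.pow 2).div_const 2)).congr_deriv ?_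
      simp only [id]
      field_simp
      ring) (by simp) hc
  rw [h', mul_assoc] at h
  have : 0 ≤ (d - 1) ^ 2 / d * ((c - 1) * (x - 1)) := by positivity
  linarith

lemma binomialExpect_mul_log_bounds {p : ℝ} (hp0 : 0 < p) (hp1 : p < 1) {M : ℕ} (hM : 0 < M) :
    (1 - p) / (2 * p) / M - (1 - p) * (1 - 2 * p) / (6 * p ^ 2) / M ^ 2
        ≤ binomialExpect p M (fun j => j / (M * p) * Real.log (j / (M * p))) ∧
      binomialExpect p M (fun j => j / (M * p) * Real.log (j / (M * p)))
        ≤ (1 - p) / (2 * p) / M - (1 - p) * (1 - 2 * p) / (6 * p ^ 2) / M ^ 2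
          + ((1 - p) ^ 2 / p ^ 2 / M ^ 2
            + (1 - p) * (1 - 6 * p * (1 - p)) / (3 * p ^ 3) / M ^ 3) := by
  have hM' : (0 : ℝ) < M := Nat.cast_pos.2 hM
  have hu (j : ℕ) : (j : ℝ) / (M * p) - 1 = (j - M * p) / (M * p) := by field_simp
  have hj (j : ℕ) : (0 : ℝ) ≤ j / (M * p) := by positivity
  constructor
  · have key := binomialExpect_quartic p M 0 (1 / (M * p)) (1 / (2 * (M * p) ^ 2))
      (-1 / (6 * (M * p) ^ 3)) 0
    refine le_of_eq_of_le (Eq.trans ?_ key.symm)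
      (binomialExpect_mono hp0.le hp1.le M fun j => ?_)
    · field_simp
      ring
    · refine le_of_eq_of_le ?_ (Real.cubic_le_mul_log (hj j))
      rw [hu]
      ring
  · have key := binomialExpect_quartic p M 0 (1 / (M * p)) (1 / (2 * (M * p) ^ 2))
      (-1 / (6 * (M * p) ^ 3)) (1 / (3 * (M * p) ^ 4))
    refine le_of_le_of_eq (binomialExpect_mono hp0.le hp1.le M fun j => ?_)
      (key.trans ?_)
    · refine (Real.mul_log_le_quartic (hj j)).trans_eq ?_
      rw [hu]
      ring
    · field_simp
      ring

lemma tendsto_mul_binomialExpect_mul_log {p : ℝ} (hp0 : 0 < p) (hp1 : p < 1) :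
    Tendsto (fun N : ℕ => (N : ℝ) * binomialExpect p (N + 1)
        (fun j => j / ((N + 1 : ℕ) * p) * Real.log (j / ((N + 1 : ℕ) * p))))
      atTop (nhds ((1 - p) / (2 * p))) := by
  have ha : Tendsto (fun N : ℕ => (N : ℝ) / (N + 1)) atTop (nhds 1) :=
    tendsto_natCast_div_add_atTop 1
  have hb : Tendsto (fun N : ℕ => 1 / ((N : ℝ) + 1)) atTop (nhds 0) :=
    tendsto_one_div_add_atTop_nhds_zero_nat
  have hlow := ha.mul (tendsto_const_nhds (x := (1 - p) / (2 * p)) |>.sub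
    (hb.const_mul ((1 - p) * (1 - 2 * p) / (6 * p ^ 2))))
  have hup := hlow.add (ha.mul ((hb.const_mul ((1 - p) ^ 2 / p ^ 2)).add
    ((hb.pow 2).const_mul ((1 - p) * (1 - 6 * p * (1 - p)) / (3 * p ^ 3)))))
  refine tendsto_of_tendsto_of_tendsto_of_le_of_le
    (by simpa using hlow) (by simpa using hup) (fun N => ?_) (fun N => ?_)
  · refine le_of_eq_of_le ?_ (mul_le_mul_of_nonneg_left
      (binomialExpect_mul_log_bounds hp0 hp1 N.succ_pos).1 N.cast_nonneg)
    push_cast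
    generalize (N : ℝ) + 1 = K
    ring
  · refine le_of_le_of_eq (mul_le_mul_of_nonneg_left
      (binomialExpect_mul_log_bounds hp0 hp1 N.succ_pos).2 N.cast_nonneg) ?_
    push_cast
    generalize (N : ℝ) + 1 = K
    ring

lemma binomialExpect_log_eq {p : ℝ} (hp0 : 0 < p) {N : ℕ} (hN : 0 < N) :
    binomialExpect p N (fun i => Real.log ((i + 1 : ℝ) / (p * N))) =
      binomialExpect p (N + 1)
        (fun j => j / ((N + 1 : ℕ) * p) * Real.log (j / ((N + 1 : ℕ) * p)))
      + Real.log (1 + 1 / N) := by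
  have hN' : (0 : ℝ) < N := Nat.cast_pos.2 hN
  have hsplit : (fun i : ℕ => Real.log ((i + 1 : ℝ) / (p * N))) = fun i : ℕ =>
      Real.log (((i + 1 : ℕ) : ℝ) / ((N + 1 : ℕ) * p)) + Real.log (1 + 1 / N) * 1 := by
    funext i
    rw [mul_one, ← Real.log_mul (by positivity) (by positivity)]
    congr 1
    push_cast
    field_simp
  have hbias := binomialExpect_succ_mul p N (fun j => Real.log (j / ((N + 1 : ℕ) * p)))
  rw [hsplit, binomialExpect_add, binomialExpect_const_mul, binomialExpect_one, mul_one]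
  congr 1
  have hscale : (fun j : ℕ => (j : ℝ) / ((N + 1 : ℕ) * p) * Real.log (j / ((N + 1 : ℕ) * p))) =
      fun j : ℕ => 1 / ((N + 1 : ℕ) * p) * (j * Real.log (j / ((N + 1 : ℕ) * p))) := by
    funext j
    ring
  rw [hscale, binomialExpect_const_mul, hbias, ← mul_assoc]
  push_cast
  rw [one_div_mul_cancel (by positivity), one_mul]

/-- For fixed `0 < p < 1`,
`N · ∑_{i=0}^{N} C(N,i) p^i (1-p)^{N-i} ln((i+1)/(pN)) → 1/(2p) + 1/2` as `N → ∞`. -/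
theorem binomial_log_limit (p : ℝ) (hp0 : 0 < p) (hp1 : p < 1) :
    Tendsto (fun N : ℕ =>
        (N : ℝ) * ∑ i ∈ Finset.range (N + 1),
          (N.choose i : ℝ) * p ^ i * (1 - p) ^ (N - i) *
            Real.log ((i + 1 : ℝ) / (p * N)))
      atTop (nhds (1 / (2 * p) + 1 / 2)) := by
  have hlog : Tendsto (fun N : ℕ => (N : ℝ) * Real.log (1 + 1 / N)) atTop (nhds 1) :=
    (Real.tendsto_mul_log_one_add_div_atTop 1).comp tendsto_natCast_atTop_atTop
  have hlim : (1 - p) / (2 * p) + 1 = 1 / (2 * p) + 1 / 2 := by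
    field_simp
    ring
  rw [← hlim]
  refine ((tendsto_mul_binomialExpect_mul_log hp0 hp1).add hlog).congr' ?_
  filter_upwards [eventually_gt_atTop 0] with N hN
  rw [← mul_add, ← binomialExpect_log_eq hp0 hN]
  rfl
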